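/- arXiv:2005.14197 — 2 statements merged into one kernel-verified Lean document; each statement's English description precedes it below -/
import Mathlib

section
/- For every integer l ≥ 1, every complex root z of the polynomial q_l satisfies Re z < 0, and the set of roots of q_l is closed under complex conjugation (if z is a root then so is its conjugate z̄). -/
open Polynomial

/-- The polynomial `p_l(z) = ∑_{k=0}^{l} ((l+k)! / (2^k k! (l−k)!)) z^{l−k}`. -/
noncomputable def pPoly (l : ℕ) : Polynomial ℂ :=
  ∑ k ∈ Finset.range (l + 1),
    C (((l + k).factorial : ℂ) / (2 ^ k * (k.factorial : ℂ) * ((l - k).factorial : ℂ))) *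
      X ^ (l - k)

/-- The polynomial `q_l(z) = z p_l'(z) − (z + l) p_l(z)`. -/
noncomputable def qPoly (l : ℕ) : Polynomial ℂ :=
  X * derivative (pPoly l) - (X + C (l : ℂ)) * pPoly l

theorem pPoly_coeff_of_lt {l n : ℕ} (h : l < n) : (pPoly l).coeff n = 0 := by
  simp only [pPoly, finsetSum_coeff, coeff_C_mul, coeff_X_pow]
  refine Finset.sum_eq_zero fun k _ => ?_
  rw [if_neg (by omega), mul_zero]

theorem pPoly_coeff_add (m n : ℕ) :
    (pPoly (n + m)).coeff n =
      ((n + 2 * m).factorial : ℂ) / (2 ^ m * (m.factorial : ℂ) * (n.factorial : ℂ)) := by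
  simp only [pPoly, finsetSum_coeff, coeff_C_mul, coeff_X_pow]
  rw [Finset.sum_eq_single m]
  · rw [if_pos (by omega), mul_one, show n + m + m = n + 2 * m by omega,
      show n + m - m = n by omega]
  · intro k hk hkm
    rw [Finset.mem_range] at hk
    rw [if_neg (by omega), mul_zero]
  · intro hm
    exact absurd (Finset.mem_range.2 (by omega)) hm

theorem pPoly_coeff_self (n : ℕ) : (pPoly n).coeff n = 1 := by
  have h := pPoly_coeff_add 0 n
  simpa [Nat.factorial_ne_zero] using h

theorem pPoly_zero : pPoly 0 = 1 := by
  simp [pPoly]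

theorem pPoly_one : pPoly 1 = X + 1 := by
  simp [pPoly, Finset.sum_range_succ]

theorem pPoly_add_two (l : ℕ) :
    pPoly (l + 2) = C (2 * l + 3 : ℂ) * pPoly (l + 1) + X ^ 2 * pPoly l := by
  ext n
  rw [coeff_add, coeff_C_mul, coeff_X_pow_mul']
  rcases n with _ | _ | k
  · have h₁ := pPoly_coeff_add (l + 2) 0
    have h₂ := pPoly_coeff_add (l + 1) 0
    simp only [zero_add] at h₁ h₂
    rw [h₁, h₂, show 2 * (l + 2) = 2 * (l + 1) + 1 + 1 by ring]
    simp only [Nat.factorial_succ (2 * (l + 1) + 1), Nat.factorial_succ (2 * (l + 1)),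
      Nat.factorial_succ (l + 1)]
    have := Nat.factorial_ne_zero (l + 1)
    have : (l + 1 + 1 : ℂ) ≠ 0 := by exact_mod_cast (l + 1).succ_ne_zero
    simp
    field_simp
    ring
  · have h₁ := pPoly_coeff_add (l + 1) 1
    have h₂ := pPoly_coeff_add l 1
    rw [zero_add, show l + 2 = 1 + (l + 1) by ring, show l + 1 = 1 + l by ring] at *
    rw [h₁, h₂, show 1 + 2 * (1 + l) = 1 + 2 * l + 1 + 1 by ring, show 1 + l = l + 1 by ring]
    simp only [Nat.factorial_succ (1 + 2 * l + 1), Nat.factorial_succ (1 + 2 * l),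
      Nat.factorial_succ l]
    have := Nat.factorial_ne_zero l
    have : (l + 1 : ℂ) ≠ 0 := by exact_mod_cast l.succ_ne_zero
    simp
    field_simp
    ring
  · rw [if_pos (by omega), show k + 1 + 1 = k + 2 by rfl, show k + 2 - 2 = k by rfl]
    rcases lt_trichotomy l k with h | rfl | h
    · rw [pPoly_coeff_of_lt (by omega), pPoly_coeff_of_lt (by omega),
        pPoly_coeff_of_lt (by omega)]
      simp
    · rw [pPoly_coeff_self, pPoly_coeff_self, pPoly_coeff_of_lt (by omega)]
      simp
    · obtain ⟨m, rfl⟩ := Nat.exists_eq_add_of_lt h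
      have h₁ := pPoly_coeff_add (m + 1) (k + 2)
      have h₂ := pPoly_coeff_add m (k + 2)
      have h₃ := pPoly_coeff_add (m + 1) k
      rw [show k + m + 1 + 2 = k + 2 + (m + 1) by ring,
        show k + m + 1 + 1 = k + 2 + m by ring, show k + m + 1 = k + (m + 1) by ring,
        h₁, h₂, h₃, show k + 2 + 2 * (m + 1) = k + 2 * m + 2 + 1 + 1 by ring,
        show k + 2 + 2 * m = k + 2 * m + 2 by ring,
        show k + 2 * (m + 1) = k + 2 * m + 2 by ring]
      simp only [Nat.factorial_succ (k + 2 * m + 2 + 1), Nat.factorial_succ (k + 2 * m + 2),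
        Nat.factorial_succ m, Nat.factorial_succ (k + 1), Nat.factorial_succ k]
      have := Nat.factorial_ne_zero m
      have := Nat.factorial_ne_zero k
      have : (m + 1 : ℂ) ≠ 0 := by exact_mod_cast m.succ_ne_zero
      have : (k + 1 : ℂ) ≠ 0 := by exact_mod_cast k.succ_ne_zero
      have : (k + 1 + 1 : ℂ) ≠ 0 := by exact_mod_cast (k + 1).succ_ne_zero
      push_cast
      field_simp
      ring

theorem derivative_pPoly_succ (l : ℕ) :
    derivative (pPoly (l + 1)) = pPoly (l + 1) - X * pPoly l := by
  ext n
  rw [coeff_derivative, coeff_sub]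
  rcases n with _ | k
  · have h₁ := pPoly_coeff_add (l + 1) 0
    have h₂ := pPoly_coeff_add l 1
    rw [zero_add] at h₁
    rw [show 1 + l = l + 1 by ring] at h₂
    rw [zero_add, h₁, h₂, mul_coeff_zero, show 0 + 2 * (l + 1) = 1 + 2 * l + 1 by ring]
    simp only [Nat.factorial_succ (1 + 2 * l), Nat.factorial_succ l]
    have := Nat.factorial_ne_zero l
    have : (l + 1 : ℂ) ≠ 0 := by exact_mod_cast l.succ_ne_zero
    simp
    field_simp
    ring
  · rw [coeff_X_mul]
    rcases lt_trichotomy l k with h | rfl | h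
    · rw [pPoly_coeff_of_lt (by omega), pPoly_coeff_of_lt (by omega),
        pPoly_coeff_of_lt (by omega)]
      simp
    · rw [pPoly_coeff_self, pPoly_coeff_self, pPoly_coeff_of_lt (by omega)]
      simp
    · obtain ⟨m, rfl⟩ := Nat.exists_eq_add_of_lt h
      have h₁ := pPoly_coeff_add m (k + 2)
      have h₂ := pPoly_coeff_add (m + 1) (k + 1)
      have h₃ := pPoly_coeff_add (m + 1) k
      rw [show k + 2 + m = k + m + 1 + 1 by ring] at h₁
      rw [show k + 1 + (m + 1) = k + m + 1 + 1 by ring] at h₂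
      rw [show k + (m + 1) = k + m + 1 by ring] at h₃
      rw [h₁, h₂, h₃, show k + 1 + 2 * (m + 1) = k + 2 * m + 2 + 1 by ring,
        show k + 2 + 2 * m = k + 2 * m + 2 by ring,
        show k + 2 * (m + 1) = k + 2 * m + 2 by ring]
      simp only [Nat.factorial_succ (k + 2 * m + 2),
        Nat.factorial_succ m, Nat.factorial_succ (k + 1), Nat.factorial_succ k]
      have := Nat.factorial_ne_zero m
      have := Nat.factorial_ne_zero k
      have : (m + 1 : ℂ) ≠ 0 := by exact_mod_cast m.succ_ne_zero
      have : (k + 1 : ℂ) ≠ 0 := by exact_mod_cast k.succ_ne_zero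
      have : (k + 1 + 1 : ℂ) ≠ 0 := by exact_mod_cast (k + 1).succ_ne_zero
      push_cast
      field_simp
      ring

theorem qPoly_succ (l : ℕ) :
    qPoly (l + 1) = -(C (l + 1 : ℂ) * pPoly (l + 1) + X ^ 2 * pPoly l) := by
  rw [qPoly, derivative_pPoly_succ]
  push_cast
  ring

theorem pPoly_map_conj (l : ℕ) : (pPoly l).map (starRingEnd ℂ) = pPoly l := by
  simp [pPoly, Polynomial.map_sum, Complex.conj_ofNat]

theorem qPoly_map_conj (l : ℕ) : (qPoly l).map (starRingEnd ℂ) = qPoly l := by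
  simp [qPoly, ← derivative_map, pPoly_map_conj]

theorem pPoly_eval_mul_conj_re_pos {z : ℂ} (hz : 0 ≤ z.re) (hz₀ : z ≠ 0) (l : ℕ) :
    0 < ((pPoly (l + 1)).eval z * starRingEnd ℂ (z * (pPoly l).eval z)).re := by
  have hn : 0 < Complex.normSq z := Complex.normSq_pos.2 hz₀
  induction l with
  | zero =>
    simp only [zero_add, pPoly_zero, pPoly_one, eval_add, eval_X, eval_one, mul_one,
      Complex.mul_re, Complex.add_re, Complex.add_im, Complex.one_re, Complex.one_im,
      Complex.conj_re, Complex.conj_im, Complex.normSq_apply] at hn ⊢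
    nlinarith
  | succ l ih =>
    rw [pPoly_add_two]
    simp only [eval_add, eval_mul, eval_C, eval_pow, eval_X]
    generalize (pPoly (l + 1)).eval z = a at *
    generalize (pPoly l).eval z = b at *
    have key : (((2 * l + 3 : ℂ) * a + z ^ 2 * b) * starRingEnd ℂ (z * a)).re =
        (2 * l + 3) * (Complex.normSq a * z.re) +
          Complex.normSq z * (a * starRingEnd ℂ (z * b)).re := by
      simp [Complex.normSq_apply, pow_two]
      ring
    rw [key]
    have := mul_nonneg (Complex.normSq_nonneg a) hz
    positivity

theorem qPoly_eval_zero_ne_zero (l : ℕ) : (qPoly (l + 1)).eval 0 ≠ 0 := by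
  have h := pPoly_coeff_add (l + 1) 0
  rw [zero_add, coeff_zero_eq_eval_zero] at h
  have : (l + 1 : ℂ) ≠ 0 := by exact_mod_cast l.succ_ne_zero
  simp [qPoly_succ, h, Nat.factorial_ne_zero, this]

theorem qPoly_eval_ne_zero {z : ℂ} (hz : 0 ≤ z.re) (l : ℕ) : (qPoly (l + 1)).eval z ≠ 0 := by
  rcases eq_or_ne z 0 with rfl | hz₀
  · exact qPoly_eval_zero_ne_zero l
  intro h
  have hp := pPoly_eval_mul_conj_re_pos hz hz₀ l
  simp only [qPoly_succ, eval_neg, neg_eq_zero, eval_add, eval_mul, eval_C, eval_pow,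
    eval_X] at h
  generalize (pPoly (l + 1)).eval z = a at *
  generalize (pPoly l).eval z = b at *
  have key : (((l + 1 : ℂ) * a + z ^ 2 * b) * starRingEnd ℂ (z * b)).re =
      (l + 1) * (a * starRingEnd ℂ (z * b)).re + Complex.normSq z * Complex.normSq b * z.re := by
    simp [Complex.normSq_apply, pow_two]
    ring
  rw [h, zero_mul, Complex.zero_re] at key
  have h₁ := mul_nonneg (mul_nonneg (Complex.normSq_nonneg z) (Complex.normSq_nonneg b)) hz
  have h₂ : 0 < (l + 1 : ℝ) * (a * starRingEnd ℂ (z * b)).re := by positivity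
  linarith

/-- For every `l ≥ 1`, every complex root of `q_l` has strictly negative real part, and the
set of roots of `q_l` is closed under complex conjugation. -/
theorem qPoly_roots_re_neg_and_conj_closed (l : ℕ) (hl : 1 ≤ l) :
    ∀ z : ℂ, (qPoly l).IsRoot z →
      z.re < 0 ∧ (qPoly l).IsRoot (starRingEnd ℂ z) := by
  intro z hz
  constructor
  · obtain ⟨m, rfl⟩ := Nat.exists_eq_add_of_le' hl
    by_contra! h
    exact qPoly_eval_ne_zero h m hz
  · have h := hz.map (f := starRingEnd ℂ)
    rwa [qPoly_map_conj] at h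
end

section
/- Let l ≥ 1 be an integer, let {z̃_j}_{j=1}^{l+1} be the (distinct) complex roots of q_l, and set β_l = l(l+1). Then for every z ∈ ℂ that is not a root of q_l: z·( z·p_l(z)/q_l(z) + 1 ) = ∑_{j=1}^{l+1} z̃_j³ / ( (z̃_j² + β_l)(z − z̃_j) ) + ∑_{j=1}^{l+1} z̃_j² / (z̃_j² + β_l). (Partial fraction decomposition of the Laplace symbol z(z·k_l(z)/(k_l(z)+z·k_l′(z)) + 1) of the NRBC kernel ρ_l.) -/
open Polynomial

theorem coeff_pPoly (l m : ℕ) : (pPoly l).coeff m =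
    if m ≤ l then ((l + (l - m)).factorial : ℂ) /
      (2 ^ (l - m) * ((l - m).factorial : ℂ) * (m.factorial : ℂ)) else 0 := by
  simp only [pPoly, finsetSum_coeff, coeff_C_mul_X_pow]
  split_ifs with h
  · rw [Finset.sum_eq_single (l - m)]
    · rw [if_pos (by omega), Nat.sub_sub_self h]
    · intro k hk hne
      rw [Finset.mem_range] at hk
      exact if_neg (by omega)
    · intro hk
      exact absurd (Finset.mem_range.2 (by omega)) hk
  · exact Finset.sum_eq_zero fun k _ => if_neg (by omega)

theorem coeff_pPoly_recurrence (l m : ℕ) :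
    2 * ((l : ℂ) - m) * (pPoly l).coeff m =
      ((m : ℂ) + 1) * (2 * l - m) * (pPoly l).coeff (m + 1) := by
  rcases lt_trichotomy m l with h | rfl | h
  · obtain ⟨k, rfl⟩ : ∃ k, l = m + k + 1 := ⟨l - m - 1, by omega⟩
    rw [coeff_pPoly, coeff_pPoly, if_pos (by omega), if_pos (by omega),
      show m + k + 1 - m = k + 1 by omega, show m + k + 1 - (m + 1) = k by omega,
      show m + k + 1 + (k + 1) = (m + k + 1 + k) + 1 by omega, Nat.factorial_succ (m + k + 1 + k),
      Nat.factorial_succ k, Nat.factorial_succ m]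
    have hk : (k : ℂ) + 1 ≠ 0 := by exact_mod_cast k.succ_ne_zero
    have hm : (m : ℂ) + 1 ≠ 0 := by exact_mod_cast m.succ_ne_zero
    have hkf : (k.factorial : ℂ) ≠ 0 := by exact_mod_cast k.factorial_ne_zero
    have hmf : (m.factorial : ℂ) ≠ 0 := by exact_mod_cast m.factorial_ne_zero
    push_cast
    field_simp
    ring
  · simp [coeff_pPoly]
  · simp [coeff_pPoly, show ¬ m ≤ l by omega, show ¬ m + 1 ≤ l by omega]

theorem pPoly_ode (l : ℕ) :
    X * derivative (derivative (pPoly l)) + C (2 * (l : ℂ)) * pPoly l =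
      C 2 * (X + C (l : ℂ)) * derivative (pPoly l) := by
  rw [mul_assoc, add_mul]
  ext m
  have h := coeff_pPoly_recurrence l m
  cases m with
  | zero =>
    simp only [coeff_add, coeff_C_mul, coeff_X_mul_zero, coeff_derivative] at h ⊢
    push_cast at h ⊢
    linear_combination h
  | succ m =>
    simp only [coeff_add, coeff_C_mul, coeff_X_mul, coeff_derivative] at h ⊢
    push_cast at h ⊢
    linear_combination h

theorem X_mul_derivative_qPoly (l : ℕ) :
    X * derivative (qPoly l) =
      (X + C (l : ℂ) + 1) * qPoly l + (X ^ 2 + C ((l : ℂ) * (l + 1))) * pPoly l := by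
  have h := pPoly_ode l
  simp only [qPoly, derivative_sub, derivative_mul, derivative_X, derivative_C,
    map_mul, map_add, map_one] at h ⊢
  have h2 : (C 2 : ℂ[X]) = 2 := rfl
  rw [h2] at h
  linear_combination X * h

theorem natDegree_pPoly_le (l : ℕ) : (pPoly l).natDegree ≤ l :=
  natDegree_le_iff_coeff_eq_zero.2 fun m hm => by rw [coeff_pPoly, if_neg (by omega)]

theorem coeff_pPoly_self (l : ℕ) : (pPoly l).coeff l = 1 := by
  rw [coeff_pPoly, if_pos le_rfl]
  simp [Nat.factorial_ne_zero]

theorem pPoly_monic (l : ℕ) : (pPoly l).Monic :=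
  monic_of_natDegree_le_of_coeff_eq_one l (natDegree_pPoly_le l) (coeff_pPoly_self l)

theorem natDegree_pPoly (l : ℕ) : (pPoly l).natDegree = l :=
  natDegree_eq_of_le_of_coeff_ne_zero (natDegree_pPoly_le l) (by simp [coeff_pPoly_self])

theorem qPoly_add_X_mul_pPoly (l : ℕ) :
    qPoly l + X * pPoly l = X * derivative (pPoly l) - C (l : ℂ) * pPoly l := by
  rw [qPoly]
  ring

theorem degree_qPoly_add_X_mul_pPoly_lt (l : ℕ) :
    (qPoly l + X * pPoly l).degree < ((l + 1 : ℕ) : WithBot ℕ) := by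
  rw [degree_lt_iff_coeff_zero]
  intro m hm
  obtain ⟨m, rfl⟩ : ∃ k, m = k + 1 := ⟨m - 1, by omega⟩
  rw [qPoly_add_X_mul_pPoly, coeff_sub, coeff_X_mul, coeff_derivative, coeff_C_mul, coeff_pPoly,
    if_neg (by omega)]
  simp

theorem eval_zero_qPoly_ne_zero {l : ℕ} (hl : 1 ≤ l) : (qPoly l).eval 0 ≠ 0 := by
  have hp : (pPoly l).eval 0 ≠ 0 := by
    rw [← coeff_zero_eq_eval_zero, coeff_pPoly, if_pos (Nat.zero_le l)]
    simp [Nat.factorial_ne_zero]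
  simp only [qPoly, eval_sub, eval_mul, eval_X, eval_add, eval_C]
  simpa [hp] using (by omega : l ≠ 0)

theorem qPoly_eq_neg_nodal {l : ℕ} {zt : Fin (l + 1) → ℂ} (hinj : Function.Injective zt)
    (hroot : ∀ j, (qPoly l).IsRoot (zt j)) : qPoly l = -Lagrange.nodal Finset.univ zt := by
  have hX : (X * pPoly l).Monic := monic_X.mul (pPoly_monic l)
  have hdeg : (X * pPoly l).degree = ((l + 1 : ℕ) : WithBot ℕ) := by
    rw [degree_mul, degree_X, degree_eq_natDegree (pPoly_monic l).ne_zero, natDegree_pPoly,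
      add_comm, Nat.cast_succ]
  have hnod : (Lagrange.nodal Finset.univ zt).degree = ((l + 1 : ℕ) : WithBot ℕ) := by
    simp [Lagrange.degree_nodal]
  refine Polynomial.eq_of_degree_sub_lt_of_eval_index_eq Finset.univ hinj.injOn ?_ fun j _ => ?_
  · have h1 : (X * pPoly l - Lagrange.nodal Finset.univ zt).degree < ((l + 1 : ℕ) : WithBot ℕ) := by
      rw [← hdeg]
      exact degree_sub_lt_left (hdeg.trans hnod.symm) hX.ne_zero
        (hX.leadingCoeff.trans (Lagrange.nodal_monic).leadingCoeff.symm)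
    rw [show qPoly l - -Lagrange.nodal Finset.univ zt =
      (qPoly l + X * pPoly l) - (X * pPoly l - Lagrange.nodal Finset.univ zt) by ring]
    simpa using (degree_sub_le _ _).trans_lt (max_lt (degree_qPoly_add_X_mul_pPoly_lt l) h1)
  · simp [Lagrange.eval_nodal_at_node, (hroot j).eq_zero]

/-- Partial fraction decomposition of the Laplace symbol of the NRBC kernel `ρ_l`:
if `{z̃_j}_{j=1}^{l+1}` are the distinct roots of `q_l` and `β_l = l(l+1)`, then for every
`z` that is not a root of `q_l`,
`z (z p_l(z)/q_l(z) + 1) = ∑_j z̃_j³/((z̃_j² + β_l)(z − z̃_j)) + ∑_j z̃_j²/(z̃_j² + β_l)`. -/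
theorem nrbc_rho_partial_fraction (l : ℕ) (hl : 1 ≤ l) (zt : Fin (l + 1) → ℂ)
    (hinj : Function.Injective zt) (hroot : ∀ j, (qPoly l).IsRoot (zt j)) :
    ∀ z : ℂ, (qPoly l).eval z ≠ 0 →
      z * (z * (pPoly l).eval z / (qPoly l).eval z + 1)
        = (∑ j, (zt j) ^ 3 / (((zt j) ^ 2 + (l : ℂ) * ((l : ℂ) + 1)) * (z - zt j)))
          + ∑ j, (zt j) ^ 2 / ((zt j) ^ 2 + (l : ℂ) * ((l : ℂ) + 1)) := by
  intro z hz
  have hq := qPoly_eq_neg_nodal hinj hroot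
  have hnode : ∀ j, z ≠ zt j := fun j h => hz (h ▸ hroot j)
  have hzt : ∀ j, zt j ≠ 0 := fun j h =>
    eval_zero_qPoly_ne_zero hl (by simpa only [h] using (hroot j).eq_zero)
  have hweight : ∀ j, Lagrange.nodalWeight Finset.univ zt j * (zt j * (pPoly l).eval (zt j)) =
      -(zt j ^ 2 / (zt j ^ 2 + (l : ℂ) * ((l : ℂ) + 1))) := by
    intro j
    have hw : Lagrange.nodalWeight Finset.univ zt j ≠ 0 :=
      Lagrange.nodalWeight_ne_zero hinj.injOn (Finset.mem_univ j)
    have hder : (derivative (qPoly l)).eval (zt j) =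
        -(Lagrange.nodalWeight Finset.univ zt j)⁻¹ := by
      rw [Lagrange.nodalWeight_eq_eval_derivative_nodal (Finset.mem_univ j), hq]
      simp
    have h := congrArg (eval (zt j)) (X_mul_derivative_qPoly l)
    simp only [eval_mul, eval_add, eval_X, eval_pow, eval_C, (hroot j).eq_zero, hder, mul_zero,
      zero_add] at h
    have hβ : zt j ^ 2 + (l : ℂ) * ((l : ℂ) + 1) ≠ 0 := by
      intro h0
      rw [h0, zero_mul] at h
      simp [hzt j, hw] at h
    field_simp at h ⊢
    linear_combination -zt j * h
  have hinterp := congrArg (eval z) (Lagrange.eq_interpolate (f := qPoly l + X * pPoly l)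
    (s := Finset.univ) hinj.injOn (by simpa using degree_qPoly_add_X_mul_pPoly_lt l))
  rw [Lagrange.eval_interpolate_not_at_node _ fun j _ => hnode j,
    ← neg_neg (Lagrange.nodal _ _), ← hq] at hinterp
  have hsum : z * (pPoly l).eval z / (qPoly l).eval z + 1 =
      ∑ j, zt j ^ 2 / (zt j ^ 2 + (l : ℂ) * ((l : ℂ) + 1)) * (z - zt j)⁻¹ := by
    rw [div_add_one hz, div_eq_iff hz]
    simp only [eval_add, eval_mul, eval_X, eval_neg, (hroot _).eq_zero, zero_add] at hinterp
    rw [add_comm, hinterp, Finset.mul_sum, Finset.sum_mul]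
    refine Finset.sum_congr rfl fun j _ => ?_
    linear_combination -(qPoly l).eval z * (z - zt j)⁻¹ * hweight j
  rw [hsum, Finset.mul_sum, ← Finset.sum_add_distrib]
  refine Finset.sum_congr rfl fun j _ => ?_
  have hsub : z - zt j ≠ 0 := sub_ne_zero.2 (hnode j)
  rw [mul_comm (_ + _) (z - zt j), ← div_div, pow_succ]
  field_simp
  ring
end
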